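/- Let k ≥ 1, a ≥ 1, b ≥ 0 and c ≥ 1 be integers, d := gcd(a, b), a' := a/d, and let p be a prime such that p | c·L_k, p ∤ a' and p | d. Then the smallest period of g_{p,k,φ} is P_{p,k,φ} = p^{e(p,k)} · (∏_{q ∈ A} q) · (∏_{q ∈ B} q), where A is the set of primes q with q ∤ ac, q | L_k, p | (q − 1) and k + 1 ≢ 0 (mod q), B is the set of primes q with q ∤ a, q | c and p | (q − 1), and e(p,k) := v_p(c) if v_p(k+1) ≥ v_p(L_k), while e(p,k) := v_p(c·L_k) if v_p(k+1) < v_p(L_k). -/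

import Mathlib

/-- `L k = lcm (1, 2, …, k)`. -/
def Lk (k : ℕ) : ℕ := (Finset.Icc 1 k).lcm id

/-- `g_{k,φ} (n) = (∏_{i=0}^{k} φ (b + a (n + i c))) / φ (lcm_{0 ≤ i ≤ k} (b + a (n + i c)))`. -/
def gkphi (k a b c n : ℕ) : ℚ :=
  (∏ i ∈ Finset.range (k + 1), ((b + a * (n + i * c)).totient : ℚ)) /
    (((Finset.range (k + 1)).lcm fun i => b + a * (n + i * c)).totient : ℚ)

section

open Finset Function

theorem Function.Periodic.nat_gcd {β : Type*} {f : ℕ → β} {S T : ℕ} (hS : Periodic f S)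
    (hT : Periodic f T) (hpos : 0 < T) : Periodic f (S.gcd T) := by
  rcases (Nat.gcd_le_right S hpos).eq_or_lt with h | h
  · rwa [h]
  · obtain ⟨m, -, hm⟩ := Nat.exists_mul_mod_eq_gcd h
    intro x
    have h1 := hT.nsmul (S * m / T) (x + S.gcd T)
    have h2 := hS.nsmul m x
    have h3 := Nat.mod_add_div (S * m) T
    simp only [smul_eq_mul] at h1 h2
    rw [← h1, ← h2]
    congr 1
    rw [hm] at h3
    linarith [mul_comm (S * m / T) T, mul_comm S m]

theorem Function.Periodic.of_dvd {β : Type*} {f : ℕ → β} {S T : ℕ} (hS : Periodic f S)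
    (h : S ∣ T) : Periodic f T := by
  obtain ⟨m, rfl⟩ := h
  simpa [mul_comm] using hS.nsmul m

theorem Function.Periodic.finset_sum {ι β : Type*} [AddCommMonoid β] {s : Finset ι} {f : ι → ℕ → β}
    {T : ℕ} (h : ∀ i ∈ s, Periodic (f i) T) : Periodic (fun n => ∑ i ∈ s, f i n) T :=
  fun n => Finset.sum_congr rfl fun i hi => h i hi n

/-- If a sum is `T`-periodic and all its terms but one are `T`-periodic, so is the last one. -/
theorem Function.Periodic.of_finset_sum {ι β : Type*} [DecidableEq ι] [AddCancelCommMonoid β]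
    {s : Finset ι} {f : ι → ℕ → β} {T : ℕ} {i : ι} (hi : i ∈ s)
    (h : Periodic (fun n => ∑ j ∈ s, f j n) T) (hf : ∀ j ∈ s, j ≠ i → Periodic (f j) T) :
    Periodic (f i) T := by
  intro n
  have h1 := h n
  simp only [← Finset.add_sum_erase s _ hi] at h1
  rw [Finset.sum_congr rfl fun j hj =>
    hf j (Finset.mem_of_mem_erase hj) (Finset.ne_of_mem_erase hj) n] at h1
  exact add_right_cancel h1

theorem Nat.Prime.pow_dvd_finset_lcm {ι : Type*} {s : Finset ι} {f : ι → ℕ} {p e : ℕ}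
    (hp : p.Prime) (he : e ≠ 0) (hf : ∀ i ∈ s, f i ≠ 0) :
    p ^ e ∣ s.lcm f ↔ ∃ i ∈ s, p ^ e ∣ f i := by
  classical
  induction s using Finset.induction_on with
  | empty => simp [he, hp.ne_one]
  | insert i s _ ih =>
    have hs : ∀ j ∈ s, f j ≠ 0 := fun j hj => hf j (Finset.mem_insert_of_mem hj)
    have hi : f i ≠ 0 := hf i (Finset.mem_insert_self i s)
    have hl : s.lcm f ≠ 0 := by simpa [Finset.lcm_eq_zero_iff] using hs
    have hl' : Nat.lcm (f i) (s.lcm f) ≠ 0 := Nat.lcm_ne_zero hi hl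
    rw [Finset.lcm_insert, lcm_eq_nat_lcm, hp.pow_dvd_iff_le_factorization hl',
      Nat.factorization_lcm hi hl, Finsupp.sup_apply, le_sup_iff,
      ← hp.pow_dvd_iff_le_factorization hi, ← hp.pow_dvd_iff_le_factorization hl, ih hs]
    simp

theorem Nat.factorization_totient_add_one {p m : ℕ} (hp : p.Prime) (hm : m ≠ 0) (hpm : p ∣ m) :
    m.totient.factorization p + 1 =
      m.factorization p + ∑ q ∈ m.primeFactors, (q - 1).factorization p := by
  have hq : ∀ q ∈ m.primeFactors, q ≠ 0 := fun q hq => (Nat.prime_of_mem_primeFactors hq).ne_zero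
  have hq' : ∀ q ∈ m.primeFactors, q - 1 ≠ 0 := fun q hq =>
    (Nat.sub_pos_of_lt (Nat.prime_of_mem_primeFactors hq).one_lt).ne'
  have h := congrArg (fun x => x.factorization p) (Nat.totient_mul_prod_primeFactors m)
  rw [Nat.factorization_mul (Nat.totient_pos.2 (Nat.pos_of_ne_zero hm)).ne'
    (Finset.prod_ne_zero_iff.2 hq), Nat.factorization_mul hm (Finset.prod_ne_zero_iff.2 hq'),
    Nat.factorization_prod hq, Nat.factorization_prod hq'] at h
  simp only [Finsupp.add_apply, Finsupp.finsetSum_apply] at h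
  rw [← h, add_right_inj]
  rw [Finset.sum_eq_single_of_mem p (Nat.mem_primeFactors.2 ⟨hp, hpm, hm⟩) fun q hq hne => ?_]
  · exact hp.factorization_self.symm
  · rw [(Nat.prime_of_mem_primeFactors hq).factorization, Finsupp.single_eq_of_ne (Ne.symm hne)]

theorem Nat.factorization_eq_card_Icc {p m N : ℕ} (hp : p.Prime) (hm : m ≠ 0)
    (hN : m.factorization p ≤ N) : m.factorization p = #{e ∈ Icc 1 N | p ^ e ∣ m} := by
  have : {e ∈ Icc 1 N | p ^ e ∣ m} = Icc 1 (m.factorization p) := by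
    ext e
    rw [Finset.mem_filter, Finset.mem_Icc, Finset.mem_Icc, hp.pow_dvd_iff_le_factorization hm]
    omega
  simp [this]

theorem Lk_ne_zero (k : ℕ) : Lk k ≠ 0 := by
  rw [Lk, Ne, Finset.lcm_eq_zero_iff]
  rintro ⟨i, hi, rfl⟩
  simp at hi

theorem dvd_Lk {k j : ℕ} (hj : 0 < j) (hjk : j ≤ k) : j ∣ Lk k :=
  Finset.dvd_lcm (f := id) (Finset.mem_Icc.2 ⟨hj, hjk⟩)

theorem exists_pow_dvd_of_pow_dvd_Lk {k p e : ℕ} (hk : 1 ≤ k) (hp : p.Prime) (h : p ^ e ∣ Lk k) :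
    ∃ j, 0 < j ∧ j ≤ k ∧ p ^ e ∣ j := by
  rcases eq_or_ne e 0 with rfl | he
  · exact ⟨1, one_pos, hk, by simp⟩
  · obtain ⟨j, hj, hd⟩ := (hp.pow_dvd_finset_lcm (f := id) he fun i hi => by
      exact Nat.ne_of_gt (Finset.mem_Icc.1 hi).1).1 h
    rw [Finset.mem_Icc] at hj
    exact ⟨j, hj.1, hj.2, hd⟩

/-- The number of terms `b + a (n + i c)`, `0 ≤ i ≤ k`, divisible by `m`. -/
def dvdCount (k a b c m n : ℕ) : ℕ := #{i ∈ range (k + 1) | m ∣ b + a * (n + i * c)}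

section dvdCount

variable {k a b c m n T : ℕ}

theorem dvd_term_add_iff (h : m ∣ a * T) (x : ℕ) : m ∣ b + a * (x + T) ↔ m ∣ b + a * x := by
  rw [mul_add, ← add_assoc]
  exact (Nat.dvd_add_left h)

theorem dvd_term_add_mul_iff (h : m ∣ a * c) (i : ℕ) :
    m ∣ b + a * (n + i * c) ↔ m ∣ b + a * n :=
  dvd_term_add_iff (by rw [mul_left_comm]; exact h.mul_left i) n

theorem periodic_dvdCount (h : m ∣ a * T) : Periodic (dvdCount k a b c m) T := by
  intro n
  simp only [dvdCount, add_right_comm n T, dvd_term_add_iff h]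

theorem dvdCount_add :
    dvdCount k a b c m (n + c) + (if m ∣ b + a * n then 1 else 0) =
      dvdCount k a b c m n + (if m ∣ b + a * (n + (k + 1) * c) then 1 else 0) := by
  have hi : ∀ i, n + c + i * c = n + (i + 1) * c := fun i => by ring
  have h := (Finset.sum_range_succ' (fun i => if m ∣ b + a * (n + i * c) then 1 else 0)
    (k + 1)).symm.trans (Finset.sum_range_succ _ (k + 1))
  simp only [zero_mul, add_zero] at h
  simp only [dvdCount, Finset.card_filter, hi]
  exact h

theorem periodic_dvdCount_of_dvd_succ (h : m ∣ a * c * (k + 1)) :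
    Periodic (dvdCount k a b c m) c := by
  intro n
  have h1 := dvdCount_add (k := k) (a := a) (b := b) (c := c) (m := m) (n := n)
  have h2 : m ∣ a * ((k + 1) * c) := by convert h using 1; ring
  simp only [dvd_term_add_iff h2] at h1
  omega

theorem dvdCount_of_dvd_mul (h : m ∣ a * c) :
    dvdCount k a b c m n = if m ∣ b + a * n then k + 1 else 0 := by
  simp only [dvdCount, dvd_term_add_mul_iff h]
  split_ifs with hn <;> simp [hn]

theorem dvdCount_eq_zero {m' : ℕ} (h : m' ∣ a * c) (hm : m' ∣ m) (hn : ¬ m' ∣ b + a * n) :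
    dvdCount k a b c m n = 0 := by
  rw [dvdCount, Finset.card_eq_zero, Finset.filter_eq_empty_iff]
  exact fun i _ hi => hn ((dvd_term_add_mul_iff h i).1 (hm.trans hi))

theorem dvd_of_two_le_dvdCount (h : 2 ≤ dvdCount k a b c m n) : m ∣ a * c * Lk k := by
  obtain ⟨i, hi, j, hj, hij⟩ := Finset.one_lt_card.1 h
  rw [Finset.mem_filter, Finset.mem_range] at hi hj
  wlog hlt : i < j generalizing i j
  · exact this j hj i hi hij.symm (by omega)
  obtain ⟨t, rfl⟩ := Nat.exists_eq_add_of_lt hlt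
  have h1 : b + a * (n + (i + t + 1) * c) = b + a * (n + i * c) + a * c * (t + 1) := by ring
  have h2 := hj.2
  rw [h1] at h2
  exact ((Nat.dvd_add_right hi.2).1 h2).trans (mul_dvd_mul_left _ (dvd_Lk (by omega) (by omega)))

theorem two_le_dvdCount {j : ℕ} (hj : 0 < j) (hjk : j ≤ k) (hm : m ∣ a * c * j)
    (hn : m ∣ b + a * n) : 2 ≤ dvdCount k a b c m n := by
  refine Finset.one_lt_card.2 ⟨0, by simpa using hn, j, ?_, hj.ne⟩
  rw [Finset.mem_filter, Finset.mem_range]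
  refine ⟨by omega, (dvd_term_add_iff ?_ n).2 hn⟩
  convert hm using 1
  ring

/-- The excess of the count decreases along `n ↦ n + c` exactly when the first term is divisible
by `m`, so a period of the excess preserves that divisibility. -/
theorem dvd_mul_of_periodic_dvdCount_sub_one {j : ℕ} (hj : 0 < j) (hjk : j ≤ k)
    (hm : m ∣ a * c * j) (hk : ¬ m ∣ a * c * (k + 1)) (hn : m ∣ b + a * n)
    (hT : Periodic (fun x => dvdCount k a b c m x - 1) T) : m ∣ a * T := by
  have h2 := two_le_dvdCount hj hjk hm hn
  have h0 := dvdCount_add (k := k) (a := a) (b := b) (c := c) (m := m) (n := n)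
  have h1 := dvdCount_add (k := k) (a := a) (b := b) (c := c) (m := m) (n := n + T)
  have hl : ¬ m ∣ b + a * (n + (k + 1) * c) := by
    intro h
    rw [mul_add, ← add_assoc, Nat.dvd_add_right hn] at h
    apply hk
    convert h using 1
    ring
  have hTn := hT n
  have hTc := hT (n + c)
  simp only [add_right_comm n c T] at hTn hTc
  have hnT : m ∣ b + a * (n + T) := by
    by_contra h
    simp only [hn, hl, h, if_true, if_false] at h0 h1
    split_ifs at h1 <;> omega
  rw [mul_add, ← add_assoc] at hnT
  exact (Nat.dvd_add_right hn).1 hnT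

end dvdCount

theorem sum_sum_dvd {k a b c n : ℕ} {ι : Type*} (s : Finset ι) (f w : ι → ℕ) :
    ∑ i ∈ range (k + 1), ∑ j ∈ s, (if f j ∣ b + a * (n + i * c) then w j else 0) =
      ∑ j ∈ s, w j * dvdCount k a b c (f j) n := by
  rw [Finset.sum_comm]
  refine Finset.sum_congr rfl fun j _ => ?_
  rw [dvdCount, Finset.card_filter, Finset.mul_sum]
  simp

theorem sum_mul_eq_add_sum_mul_sub_one {ι : Type*} (s : Finset ι) (f w : ι → ℕ)
    (h : ∀ j ∈ s, 1 ≤ f j) :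
    ∑ j ∈ s, w j * f j = ∑ j ∈ s, w j + ∑ j ∈ s, w j * (f j - 1) := by
  rw [← Finset.sum_add_distrib]
  refine Finset.sum_congr rfl fun j hj => ?_
  obtain ⟨t, ht⟩ := Nat.exists_eq_add_of_le (h j hj)
  simp [ht, mul_add]

/-- The contribution of the prime `q` to the `p`-adic valuation of `gkphi k a b c n`. -/
def localTerm (k a b c p q n : ℕ) : ℕ :=
  if q = p then ∑ e ∈ Icc 1 ((a * c * Lk k).factorization p), (dvdCount k a b c (p ^ e) n - 1)
  else (q - 1).factorization p * (dvdCount k a b c q n - 1)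

theorem sum_localTerm {k a b c p n : ℕ} (hp : p.Prime) (hmem : p ∈ (a * c * Lk k).primeFactors) :
    ∑ q ∈ (a * c * Lk k).primeFactors, localTerm k a b c p q n =
      ∑ e ∈ Icc 1 ((a * c * Lk k).factorization p), (dvdCount k a b c (p ^ e) n - 1) +
      ∑ q ∈ (a * c * Lk k).primeFactors,
        (q - 1).factorization p * (dvdCount k a b c q n - 1) := by
  have h0 : (p - 1).factorization p = 0 := Nat.factorization_eq_zero_of_not_dvd fun h =>
    absurd (Nat.le_of_dvd (Nat.sub_pos_of_lt hp.one_lt) h) (by have := hp.pos; omega)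
  rw [← Finset.add_sum_erase _ _ hmem,
    ← Finset.add_sum_erase _ (fun q => (q - 1).factorization p * _) hmem]
  simp only [h0, zero_mul, zero_add]
  congr 1
  · simp [localTerm]
  · exact Finset.sum_congr rfl fun q hq => by simp [localTerm, Finset.ne_of_mem_erase hq]

theorem padicValRat_gkphi {k a b c p n : ℕ} (ha : 1 ≤ a) (hc : 1 ≤ c) (hn : 0 < n) (hp : p.Prime)
    (hpa : p ∣ a) (hpb : p ∣ b) :
    padicValRat p (gkphi k a b c n) =
      ((∑ q ∈ (a * c * Lk k).primeFactors, localTerm k a b c p q n : ℕ) : ℤ) - k := by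
  have : Fact p.Prime := ⟨hp⟩
  set M := a * c * Lk k with hM
  have hM0 : M ≠ 0 := mul_ne_zero (mul_ne_zero (by omega) (by omega)) (Lk_ne_zero k)
  set x : ℕ → ℕ := fun i => b + a * (n + i * c) with hx
  have hx0 : ∀ i, x i ≠ 0 := fun i => by
    have : 0 < a * (n + i * c) := Nat.mul_pos ha (by omega)
    simp only [hx]
    omega
  have hpx : ∀ i, p ∣ x i := fun i => dvd_add hpb (hpa.mul_right _)
  set l := (range (k + 1)).lcm x with hl
  have hl0 : l ≠ 0 := by
    rw [hl, Ne, Finset.lcm_eq_zero_iff]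
    rintro ⟨i, -, hi⟩
    exact hx0 i hi
  have hxl : ∀ i ∈ range (k + 1), x i ∣ l := fun i hi => Finset.dvd_lcm hi
  have hcount : ∀ q e : ℕ, q.Prime → e ≠ 0 → (q ^ e ∣ l ↔ 1 ≤ dvdCount k a b c (q ^ e) n) := by
    intro q e hq he
    rw [hl, hq.pow_dvd_finset_lcm he fun i _ => hx0 i, dvdCount, Nat.succ_le_iff,
      Finset.card_pos, Finset.filter_nonempty_iff]
  have hdvdM : ∀ m, ¬ m ∣ M → dvdCount k a b c m n - 1 = 0 := fun m hm => by
    by_contra h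
    exact hm (dvd_of_two_le_dvdCount (n := n) (b := b) (by omega))
  -- the contribution of the valuations of the terms themselves
  have hA : ∑ i ∈ range (k + 1), (x i).factorization p =
      l.factorization p + ∑ e ∈ Icc 1 (M.factorization p), (dvdCount k a b c (p ^ e) n - 1) := by
    have h1 : ∀ i ∈ range (k + 1), (x i).factorization p =
        ∑ e ∈ Icc 1 (l.factorization p), if p ^ e ∣ b + a * (n + i * c) then 1 else 0 := by
      intro i hi
      rw [Nat.factorization_eq_card_Icc hp (hx0 i)
        ((Nat.factorization_le_iff_dvd (hx0 i) hl0).2 (hxl i hi) p), Finset.card_filter]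
    rw [Finset.sum_congr rfl h1, sum_sum_dvd _ (fun e => p ^ e) (fun _ => 1),
      sum_mul_eq_add_sum_mul_sub_one]
    · simp only [one_mul, Finset.sum_const, Nat.card_Icc, smul_eq_mul, mul_one,
        Nat.add_sub_cancel, add_right_inj]
      refine Finset.sum_congr_of_eq_on_inter (fun e he he' => ?_) (fun e he he' => ?_)
        fun e _ _ => rfl
      · apply hdvdM
        rw [hp.pow_dvd_iff_le_factorization hM0]
        rw [Finset.mem_Icc] at he he'
        omega
      · rw [Finset.mem_Icc] at he he'
        have := mt (hcount p e hp (by omega)).2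
        rw [hp.pow_dvd_iff_le_factorization hl0] at this
        omega
    · intro e he
      rw [Finset.mem_Icc] at he
      exact (hcount p e hp (by omega)).1 ((hp.pow_dvd_iff_le_factorization hl0).2 he.2)
  -- the contribution of the primes dividing the terms
  have hB : ∑ i ∈ range (k + 1), ∑ q ∈ (x i).primeFactors, (q - 1).factorization p =
      ∑ q ∈ l.primeFactors, (q - 1).factorization p +
        ∑ q ∈ M.primeFactors, (q - 1).factorization p * (dvdCount k a b c q n - 1) := by
    have h1 : ∀ i ∈ range (k + 1), ∑ q ∈ (x i).primeFactors, (q - 1).factorization p =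
        ∑ q ∈ l.primeFactors,
          if q ∣ b + a * (n + i * c) then (q - 1).factorization p else 0 := by
      intro i hi
      rw [← Finset.sum_filter]
      refine Finset.sum_congr ?_ fun _ _ => rfl
      ext q
      rw [Finset.mem_filter, Nat.mem_primeFactors, Nat.mem_primeFactors]
      exact ⟨fun h => ⟨⟨h.1, h.2.1.trans (hxl i hi), hl0⟩, h.2.1⟩,
        fun h => ⟨h.1.1, h.2, hx0 i⟩⟩
    rw [Finset.sum_congr rfl h1, sum_sum_dvd _ (fun q => q),
      sum_mul_eq_add_sum_mul_sub_one]
    · rw [add_right_inj]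
      refine Finset.sum_congr_of_eq_on_inter (fun q hq hq' => ?_) (fun q hq hq' => ?_)
        fun q _ _ => rfl
      · rw [hdvdM q fun h => hq' (Nat.mem_primeFactors.2
          ⟨Nat.prime_of_mem_primeFactors hq, h, hM0⟩), mul_zero]
      · have hqp := Nat.prime_of_mem_primeFactors hq
        have := mt (hcount q 1 hqp one_ne_zero).2 (by
          rw [pow_one]
          exact fun h => hq' (Nat.mem_primeFactors.2 ⟨hqp, h, hl0⟩))
        rw [pow_one] at this
        rw [show dvdCount k a b c q n - 1 = 0 by omega, mul_zero]
    · intro q hq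
      have := (hcount q 1 (Nat.prime_of_mem_primeFactors hq) one_ne_zero).1
      rw [pow_one] at this
      exact this (Nat.dvd_of_mem_primeFactors hq)
  have htot : ∑ i ∈ range (k + 1), (x i).totient.factorization p + (k + 1) =
      ∑ i ∈ range (k + 1), (x i).factorization p +
        ∑ i ∈ range (k + 1), ∑ q ∈ (x i).primeFactors, (q - 1).factorization p := by
    rw [← Finset.sum_add_distrib,
      ← Finset.sum_congr rfl fun i _ => Nat.factorization_totient_add_one hp (hx0 i) (hpx i)]
    simp [Finset.sum_add_distrib]
  have htotl := Nat.factorization_totient_add_one hp hl0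
    ((hpx 0).trans (hxl 0 (Finset.mem_range.2 k.succ_pos)))
  have hφ : ∀ i ∈ range (k + 1), (x i).totient ≠ 0 := fun i _ =>
    (Nat.totient_pos.2 (Nat.pos_of_ne_zero (hx0 i))).ne'
  have hφl : l.totient ≠ 0 := (Nat.totient_pos.2 (Nat.pos_of_ne_zero hl0)).ne'
  have hg : gkphi k a b c n = ((∏ i ∈ range (k + 1), (x i).totient : ℕ) : ℚ) / (l.totient : ℚ) := by
    rw [gkphi, Nat.cast_prod]
  rw [hg, padicValRat.div (Nat.cast_ne_zero.2 (Finset.prod_ne_zero_iff.2 hφ))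
    (Nat.cast_ne_zero.2 hφl), padicValRat.of_nat, padicValRat.of_nat, ← Nat.factorization_def _ hp,
    ← Nat.factorization_def _ hp, Nat.factorization_prod hφ, Finsupp.finsetSum_apply,
    sum_localTerm hp (Nat.mem_primeFactors.2
      ⟨hp, (hpa.mul_right c).mul_right (Lk k), hM0⟩), ← hM]
  omega

theorem exists_dvd_add_mul {a m : ℕ} (b : ℕ) (h : a.Coprime m) (hm : m ≠ 0) :
    ∃ n, m ∣ b + a * n := by
  obtain ⟨n, -, hn⟩ := Nat.exists_mul_mod_eq_of_coprime (b * (m - 1)) h hm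
  refine ⟨n, (Nat.modEq_zero_iff_dvd).1 ?_⟩
  have h1 : b + a * n ≡ b + b * (m - 1) [MOD m] := Nat.ModEq.add_left b hn
  refine h1.trans ((Nat.modEq_zero_iff_dvd).2 ⟨b, ?_⟩)
  obtain ⟨t, rfl⟩ := Nat.exists_eq_succ_of_ne_zero hm
  simp only [Nat.succ_eq_add_one, Nat.add_sub_cancel]
  ring

section localTerm

variable {k a b c p q T : ℕ}

theorem periodic_dvdCount_sub_one {m : ℕ} (h : Periodic (dvdCount k a b c m) T) :
    Periodic (fun n => dvdCount k a b c m n - 1) T :=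
  h.comp (· - 1)

theorem periodic_localTerm_self
    (h : ∀ e ≤ (a * c * Lk k).factorization p, Periodic (dvdCount k a b c (p ^ e)) T) :
    Periodic (localTerm k a b c p p) T := by
  have : localTerm k a b c p p = fun n => ∑ e ∈ Icc 1 ((a * c * Lk k).factorization p),
      (dvdCount k a b c (p ^ e) n - 1) := by
    funext n
    simp [localTerm]
  rw [this]
  exact Periodic.finset_sum fun e he =>
    periodic_dvdCount_sub_one (h e (Finset.mem_Icc.1 he).2)

theorem periodic_localTerm (hqp : q ≠ p) (h : Periodic (dvdCount k a b c q) T) :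
    Periodic (localTerm k a b c p q) T := by
  intro n
  simp only [localTerm, if_neg hqp, h n]

theorem periodic_dvdCount_sub_one_of_localTerm (hp : p.Prime) (hq : q.Prime) (hpq : p ∣ q - 1)
    (h : Periodic (localTerm k a b c p q) T) :
    Periodic (fun n => dvdCount k a b c q n - 1) T := by
  have hq1 : 0 < q - 1 := Nat.sub_pos_of_lt hq.one_lt
  have hqp : q ≠ p := by
    rintro rfl
    have := Nat.le_of_dvd hq1 hpq
    omega
  intro n
  have := h n
  simp only [localTerm, if_neg hqp] at this
  exact Nat.eq_of_mul_eq_mul_left (hp.factorization_pos_of_dvd hq1.ne' hpq) this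

theorem periodic_localTerm_of_not_dvd (hqp : q ≠ p) (h : ¬ p ∣ q - 1) :
    Periodic (localTerm k a b c p q) T := by
  intro n
  simp [localTerm, hqp, Nat.factorization_eq_zero_of_not_dvd h]

/-- A period of the excess of the count of terms divisible by `q` is a multiple of `q`
in the case `q ∣ c`, `q ∤ a`. -/
theorem dvd_of_periodic_of_dvd_common_difference (hk : 1 ≤ k) (hq : q.Prime) (hqa : ¬ q ∣ a)
    (hqc : q ∣ c) (h : Periodic (fun n => dvdCount k a b c q n - 1) T) : q ∣ T := by
  obtain ⟨n, hn⟩ := exists_dvd_add_mul b ((hq.coprime_iff_not_dvd.2 hqa).symm) hq.ne_zero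
  have h1 := h n
  simp only [dvdCount_of_dvd_mul (hqc.mul_left a), if_pos hn] at h1
  have h2 : q ∣ b + a * (n + T) := by
    by_contra h2
    rw [if_neg h2] at h1
    omega
  rw [mul_add, ← add_assoc, Nat.dvd_add_right hn] at h2
  exact (hq.dvd_mul.1 h2).resolve_left hqa

/-- A period of the excess of the count of terms divisible by `q` is a multiple of `q`
in the case `q ∣ L_k`, `q ∤ a c (k + 1)`. -/
theorem dvd_of_periodic_of_dvd_Lk (hk : 1 ≤ k) (hq : q.Prime) (hqac : ¬ q ∣ a * c)
    (hqL : q ∣ Lk k) (hqk : ¬ q ∣ k + 1)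
    (h : Periodic (fun n => dvdCount k a b c q n - 1) T) : q ∣ T := by
  have hqa : ¬ q ∣ a := fun hd => hqac (hd.mul_right c)
  obtain ⟨n, hn⟩ := exists_dvd_add_mul b ((hq.coprime_iff_not_dvd.2 hqa).symm) hq.ne_zero
  obtain ⟨j, hj, hjk, hd⟩ := exists_pow_dvd_of_pow_dvd_Lk (e := 1) hk hq (by simpa using hqL)
  rw [pow_one] at hd
  have := dvd_mul_of_periodic_dvdCount_sub_one hj hjk (hd.mul_left _)
    (fun hd => (hq.dvd_mul.1 hd).elim hqac hqk) hn h
  exact (hq.dvd_mul.1 this).resolve_left hqa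

theorem factorization_mul_mul {x : ℕ} (ha : 1 ≤ a) (hc : 1 ≤ c) (hx : x ≠ 0) :
    (a * c * x).factorization p =
      a.factorization p + c.factorization p + x.factorization p := by
  rw [Nat.factorization_mul (mul_ne_zero (by omega) (by omega)) hx,
    Nat.factorization_mul (by omega) (by omega)]
  rfl

theorem periodic_localTerm_self_pow (ha : 1 ≤ a) (hc : 1 ≤ c) :
    Periodic (localTerm k a b c p p) (p ^ (c.factorization p + (Lk k).factorization p)) := by
  refine periodic_localTerm_self fun e he => periodic_dvdCount ?_
  rw [factorization_mul_mul ha hc (Lk_ne_zero k), add_assoc] at he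
  refine (pow_dvd_pow p he).trans ?_
  rw [pow_add]
  exact mul_dvd_mul_right (Nat.ordProj_dvd a p) _

theorem periodic_localTerm_self_of_le (ha : 1 ≤ a) (hc : 1 ≤ c) (hp : p.Prime)
    (h : (Lk k).factorization p ≤ (k + 1).factorization p) :
    Periodic (localTerm k a b c p p) (p ^ c.factorization p) := by
  have hpc : Periodic (localTerm k a b c p p) c := by
    refine periodic_localTerm_self fun e he => periodic_dvdCount_of_dvd_succ ?_
    rw [factorization_mul_mul ha hc (Lk_ne_zero k)] at he
    rw [hp.pow_dvd_iff_le_factorization (mul_ne_zero (mul_ne_zero (by omega) (by omega))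
      k.add_one_ne_zero), factorization_mul_mul ha hc k.add_one_ne_zero]
    omega
  have hg := hpc.nat_gcd (periodic_localTerm_self_pow ha hc) (pow_pos hp.pos _)
  refine hg.of_dvd ?_
  obtain ⟨j, -, hj⟩ := (Nat.dvd_prime_pow hp).1
    (Nat.gcd_dvd_right c (p ^ (c.factorization p + (Lk k).factorization p)))
  have hjc := Nat.gcd_dvd_left c (p ^ (c.factorization p + (Lk k).factorization p))
  rw [hj] at hjc ⊢
  exact pow_dvd_pow p ((hp.pow_dvd_iff_le_factorization (by omega)).1 hjc)

theorem pow_dvd_of_pow_dvd_mul {e : ℕ} (ha : 1 ≤ a) (hp : p.Prime) (hT : T ≠ 0)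
    (h : p ^ (a.factorization p + e) ∣ a * T) :
    p ^ e ∣ T := by
  rw [hp.pow_dvd_iff_le_factorization (mul_ne_zero (by omega) hT),
    Nat.factorization_mul (by omega) hT, Finsupp.add_apply] at h
  rw [hp.pow_dvd_iff_le_factorization hT]
  omega

theorem pow_factorization_dvd_of_periodic (hk : 1 ≤ k) (ha : 1 ≤ a) (hc : 1 ≤ c) (hp : p.Prime)
    (hpa : p ∣ a)
    (hroot : ∀ N, ∃ n, p ^ N ∣ b + a * n) (hT : T ≠ 0)
    (h : Periodic (localTerm k a b c p p) T) : p ^ c.factorization p ∣ T := by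
  set s := a.factorization p + c.factorization p with hs
  have hs1 : 1 ≤ s := by
    have := hp.factorization_pos_of_dvd (by omega) hpa
    omega
  have hsE : s ≤ (a * c * Lk k).factorization p := by
    rw [factorization_mul_mul ha hc (Lk_ne_zero k)]
    omega
  have hsac : p ^ s ∣ a * c := by
    rw [hs, pow_add]
    exact mul_dvd_mul (Nat.ordProj_dvd a p) (Nat.ordProj_dvd c p)
  obtain ⟨n, hn⟩ := hroot s
  refine pow_dvd_of_pow_dvd_mul ha hp hT ?_
  rw [← hs]
  by_contra hcon
  have hnT : ¬ p ^ s ∣ b + a * (n + T) := by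
    rwa [mul_add, ← add_assoc, Nat.dvd_add_right hn]
  have hsn : dvdCount k a b c (p ^ s) n = k + 1 := by rw [dvdCount_of_dvd_mul hsac, if_pos hn]
  have hsnT : ∀ e, s ≤ e → dvdCount k a b c (p ^ e) (n + T) = 0 := fun e he =>
    dvdCount_eq_zero hsac (pow_dvd_pow p he) hnT
  refine (h n).not_lt ?_
  simp only [localTerm, if_true]
  refine Finset.sum_lt_sum (fun e _ => ?_) ⟨s, Finset.mem_Icc.2 ⟨hs1, hsE⟩, ?_⟩
  · rcases le_total s e with he | he
    · simp [hsnT e he]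
    · have hd := pow_dvd_pow p he
      rw [dvdCount_of_dvd_mul (hd.trans hsac), dvdCount_of_dvd_mul (hd.trans hsac),
        if_pos (hd.trans hn)]
      split_ifs <;> omega
  · rw [hsnT s le_rfl, hsn]
    omega

theorem pow_factorization_add_dvd_of_periodic (hk : 1 ≤ k) (ha : 1 ≤ a) (hc : 1 ≤ c) (hp : p.Prime)
    (hroot : ∀ N, ∃ n, p ^ N ∣ b + a * n)
    (hlt : (k + 1).factorization p < (Lk k).factorization p)
    (h : Periodic (localTerm k a b c p p) T) :
    p ^ (c.factorization p + (Lk k).factorization p) ∣ T := by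
  set E := c.factorization p + (Lk k).factorization p with hE
  have hEM : (a * c * Lk k).factorization p = a.factorization p + E := by
    rw [factorization_mul_mul ha hc (Lk_ne_zero k), hE, add_assoc]
  have hg := h.nat_gcd (periodic_localTerm_self_pow ha hc) (pow_pos hp.pos _)
  obtain ⟨j, hjE, hj⟩ := (Nat.dvd_prime_pow hp).1 (Nat.gcd_dvd_right T (p ^ E))
  rw [← hE, hj] at hg
  rcases hjE.eq_or_lt with rfl | hjlt
  · rw [← hj]
    exact Nat.gcd_dvd_left _ _
  exfalso
  have hR : Periodic (localTerm k a b c p p) (p ^ (E - 1)) :=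
    hg.of_dvd (pow_dvd_pow p (by omega))
  have hfun : localTerm k a b c p p = fun n => ∑ e ∈ Icc 1 (a.factorization p + E),
      (dvdCount k a b c (p ^ e) n - 1) := by
    funext n
    simp [localTerm, hEM]
  rw [hfun] at hR
  have htop := hR.of_finset_sum (f := fun e n => dvdCount k a b c (p ^ e) n - 1)
    (i := a.factorization p + E) (Finset.mem_Icc.2 ⟨by omega, le_rfl⟩) fun e he hne => by
      rw [Finset.mem_Icc] at he
      refine periodic_dvdCount_sub_one (periodic_dvdCount ?_)
      refine (pow_dvd_pow p (show e ≤ a.factorization p + (E - 1) by omega)).trans ?_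
      rw [pow_add]
      exact mul_dvd_mul_right (Nat.ordProj_dvd a p) _
  obtain ⟨n, hn⟩ := hroot (a.factorization p + E)
  obtain ⟨i, hi, hik, hd⟩ := exists_pow_dvd_of_pow_dvd_Lk hk hp (Nat.ordProj_dvd (Lk k) p)
  have hdvd : p ^ (a.factorization p + E) ∣ a * c * i := by
    rw [hE, ← add_assoc, pow_add, pow_add]
    exact mul_dvd_mul (mul_dvd_mul (Nat.ordProj_dvd a p) (Nat.ordProj_dvd c p)) hd
  have hnot : ¬ p ^ (a.factorization p + E) ∣ a * c * (k + 1) := by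
    rw [hp.pow_dvd_iff_le_factorization (mul_ne_zero (mul_ne_zero (by omega) (by omega))
      k.add_one_ne_zero), factorization_mul_mul ha hc k.add_one_ne_zero]
    omega
  have := pow_dvd_of_pow_dvd_mul ha hp (pow_ne_zero _ hp.ne_zero)
    (dvd_mul_of_periodic_dvdCount_sub_one hi hik hdvd hnot hn htop)
  rw [Nat.pow_dvd_pow_iff_le_right hp.one_lt] at this
  omega

theorem periodic_localTerm_prime (q : ℕ) :
    Periodic (localTerm k a b c p q)
      (if q = p then p ^ (a * c * Lk k).factorization p else q) := by
  split_ifs with h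
  · subst h
    exact periodic_localTerm_self fun e he =>
      periodic_dvdCount ((pow_dvd_pow q he).mul_left a)
  · exact periodic_localTerm h (periodic_dvdCount (dvd_mul_left q a))

theorem periodic_localTerm_one (hq : q.Prime) (hqp : q ≠ p) (hqM : q ∣ a * c * Lk k)
    (hA : ¬ q ∣ a * c → q ∣ Lk k → p ∣ q - 1 → q ∣ k + 1)
    (hB : ¬ q ∣ a → q ∣ c → ¬ p ∣ q - 1) : Periodic (localTerm k a b c p q) 1 := by
  by_cases hpq : p ∣ q - 1
  swap
  · exact periodic_localTerm_of_not_dvd hqp hpq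
  by_cases hqa : q ∣ a
  · exact periodic_localTerm hqp (periodic_dvdCount (by simpa using hqa))
  have hqc : ¬ q ∣ c := fun h => hB hqa h hpq
  have hqac : ¬ q ∣ a * c := fun h => (hq.dvd_mul.1 h).elim hqa hqc
  have hqk := hA hqac ((hq.dvd_mul.1 hqM).resolve_left hqac) hpq
  have h := (periodic_dvdCount_of_dvd_succ (b := b) (hqk.mul_left (a * c))).nat_gcd
    (periodic_dvdCount (dvd_mul_left q a)) hq.pos
  rw [((hq.coprime_iff_not_dvd.2 hqc).symm : c.gcd q = 1)] at h
  exact periodic_localTerm hqp h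

/-- A period of the sum of all local terms yields periods of the individual ones. -/
theorem exists_coprime_periodic_localTerm (hp : p.Prime)
    (hq : q ∈ (a * c * Lk k).primeFactors)
    (h : Periodic (fun n => ∑ r ∈ (a * c * Lk k).primeFactors, localTerm k a b c p r n) T) :
    ∃ M, M ≠ 0 ∧ q.Coprime M ∧ Periodic (localTerm k a b c p q) (T * M) := by
  set m : ℕ → ℕ := fun r => if r = p then p ^ (a * c * Lk k).factorization p else r with hm
  have hq' := Nat.prime_of_mem_primeFactors hq
  refine ⟨∏ r ∈ (a * c * Lk k).primeFactors.erase q, m r, ?_, ?_, ?_⟩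
  · refine Finset.prod_ne_zero_iff.2 fun r hr => ?_
    simp only [hm]
    split_ifs
    · exact pow_ne_zero _ hp.ne_zero
    · exact (Nat.prime_of_mem_primeFactors (Finset.mem_of_mem_erase hr)).ne_zero
  · refine Nat.Coprime.prod_right fun r hr => ?_
    have hr' := Nat.prime_of_mem_primeFactors (Finset.mem_of_mem_erase hr)
    have hne := (Nat.coprime_primes hq' hr').2 (Finset.ne_of_mem_erase hr).symm
    simp only [hm]
    split_ifs with hrp
    · subst hrp
      exact hne.pow_right _
    · exact hne
  · refine (h.of_dvd (dvd_mul_right T _)).of_finset_sum hq fun r hr hne => ?_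
    exact (periodic_localTerm_prime r).of_dvd
      ((Finset.dvd_prod_of_mem m (Finset.mem_erase.2 ⟨hne, hr⟩)).mul_left T)

end localTerm

end

/-- Lemma 3.7: for a prime `p` with `p ∣ c L_k`, `p ∤ a'` and `p ∣ d`
(`d = gcd (a, b)`, `a' = a / d`), the smallest period of
`g_{p,k,φ} (n) = v_p (g_{k,φ} (n))` is `p ^ e (p, k)` times
`(∏_{q prime, q ∤ a c, q ∣ L_k, p ∣ q − 1, q ∤ k + 1} q) ⬝ (∏_{q prime, q ∤ a, q ∣ c, p ∣ q − 1} q)`,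
where `e (p, k) = v_p (c)` if `v_p (k + 1) ≥ v_p (L_k)`, and
`e (p, k) = v_p (c L_k)` if `v_p (k + 1) < v_p (L_k)`. -/
theorem smallest_local_period_not_dvd_a'_dvd_d (k a b c : ℕ)
    (hk : 1 ≤ k) (ha : 1 ≤ a) (hc : 1 ≤ c)
    (d a' : ℕ) (hd : d = Nat.gcd a b) (ha' : a' = a / d)
    (p : ℕ) (hp : p.Prime) (hpdvd : p ∣ c * Lk k) (hpa' : ¬ p ∣ a') (hpd : p ∣ d) :
    IsLeast {T : ℕ | 0 < T ∧ ∀ n : ℕ, 0 < n →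
        padicValRat p (gkphi k a b c (n + T)) = padicValRat p (gkphi k a b c n)}
      (p ^ (if padicValNat p (Lk k) ≤ padicValNat p (k + 1) then padicValNat p c
            else padicValNat p (c * Lk k)) *
        ((∏ q ∈ (Lk k).divisors.filter
            (fun q => q.Prime ∧ ¬ q ∣ a * c ∧ p ∣ (q - 1) ∧ ¬ q ∣ (k + 1)), q) *
          ∏ q ∈ c.divisors.filter (fun q => q.Prime ∧ ¬ q ∣ a ∧ p ∣ (q - 1)), q)) := by
  classical
  subst hd ha'
  have hpa : p ∣ a := hpd.trans (Nat.gcd_dvd_left a b)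
  have hpb : p ∣ b := hpd.trans (Nat.gcd_dvd_right a b)
  have hM0 : a * c * Lk k ≠ 0 := mul_ne_zero (mul_ne_zero (by omega) (by omega)) (Lk_ne_zero k)
  have hroot : ∀ N, ∃ n, p ^ N ∣ b + a * n := by
    intro N
    obtain ⟨n, hn⟩ := exists_dvd_add_mul (b / a.gcd b)
      (((hp.coprime_iff_not_dvd.2 hpa').pow_left N).symm) (pow_ne_zero N hp.ne_zero)
    refine ⟨n, hn.trans ⟨a.gcd b, ?_⟩⟩
    rw [add_mul, Nat.div_mul_cancel (Nat.gcd_dvd_right a b), mul_right_comm,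
      Nat.div_mul_cancel (Nat.gcd_dvd_left a b)]
  set F : ℕ → ℕ := fun n => ∑ q ∈ (a * c * Lk k).primeFactors, localTerm k a b c p q n with hF
  have hper : ∀ T, (∀ n : ℕ, 0 < n →
      padicValRat p (gkphi k a b c (n + T)) = padicValRat p (gkphi k a b c n)) ↔
      ∀ n : ℕ, 0 < n → F (n + T) = F n := by
    refine fun T => forall₂_congr fun n hn => ?_
    rw [padicValRat_gkphi ha hc (Nat.add_pos_left hn T) hp hpa hpb,
      padicValRat_gkphi ha hc hn hp hpa hpb, sub_left_inj, Nat.cast_inj]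
  simp only [hper]
  rw [← Nat.factorization_def _ hp, ← Nat.factorization_def _ hp, ← Nat.factorization_def _ hp,
    ← Nat.factorization_def _ hp, Nat.factorization_mul (by omega) (Lk_ne_zero k),
    Finsupp.add_apply]
  set A := (Lk k).divisors.filter
    (fun q => q.Prime ∧ ¬ q ∣ a * c ∧ p ∣ (q - 1) ∧ ¬ q ∣ (k + 1)) with hA
  set B := c.divisors.filter (fun q => q.Prime ∧ ¬ q ∣ a ∧ p ∣ (q - 1)) with hB
  have hmemA : ∀ q, q ∈ A ↔ q ∣ Lk k ∧ q.Prime ∧ ¬ q ∣ a * c ∧ p ∣ (q - 1) ∧ ¬ q ∣ (k + 1) := by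
    intro q
    simp [hA, Lk_ne_zero]
  have hmemB : ∀ q, q ∈ B ↔ q ∣ c ∧ q.Prime ∧ ¬ q ∣ a ∧ p ∣ (q - 1) := by
    intro q
    rw [hB, Finset.mem_filter, Nat.mem_divisors, and_iff_left (show c ≠ 0 by omega)]
  have hAB : Disjoint A B := by
    rw [Finset.disjoint_left]
    intro q h1 h2
    exact ((hmemA q).1 h1).2.2.1 (((hmemB q).1 h2).1.mul_left a)
  rw [← Finset.prod_union hAB]
  have hprime : ∀ q ∈ A ∪ B, q.Prime := by
    intro q hq
    rcases Finset.mem_union.1 hq with h | h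
    · exact ((hmemA q).1 h).2.1
    · exact ((hmemB q).1 h).2.1
  refine ⟨⟨?_, fun n _ => ?_⟩, ?_⟩
  · exact Nat.mul_pos (pow_pos hp.pos _) (Finset.prod_pos fun q hq => (hprime q hq).pos)
  · refine Function.Periodic.finset_sum (fun q hq => ?_) n
    have hq' := Nat.prime_of_mem_primeFactors hq
    rcases eq_or_ne q p with rfl | hqp
    · refine Function.Periodic.of_dvd ?_ (dvd_mul_right _ _)
      split_ifs with h
      · exact periodic_localTerm_self_of_le ha hc hp h
      · exact periodic_localTerm_self_pow ha hc
    · by_cases hqAB : q ∈ A ∪ B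
      · exact (periodic_localTerm hqp (periodic_dvdCount (dvd_mul_left q a))).of_dvd
          ((Finset.dvd_prod_of_mem _ hqAB).mul_left _)
      · rw [Finset.mem_union, not_or, hmemA, hmemB] at hqAB
        refine (periodic_localTerm_one hq' hqp (Nat.dvd_of_mem_primeFactors hq)
          (fun h1 h2 h3 => ?_) fun h1 h2 h3 => hqAB.2 ⟨h2, hq', h1, h3⟩).of_dvd (one_dvd _)
        by_contra h4
        exact hqAB.1 ⟨h2, hq', h1, h3, h4⟩
  · rintro T ⟨hT, hTper⟩
    have hFT : Function.Periodic F T := by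
      -- `F` is periodic on all of `ℕ`, so the identity extends to `n = 0`
      obtain ⟨S, hS, hFS⟩ : ∃ S, 0 < S ∧ Function.Periodic F S := by
        refine ⟨p ^ (a * c * Lk k).factorization p * (a * c * Lk k),
          Nat.mul_pos (pow_pos hp.pos _) (Nat.pos_of_ne_zero hM0),
          Function.Periodic.finset_sum fun q hq => (periodic_localTerm_prime q).of_dvd ?_⟩
        split_ifs
        · exact dvd_mul_right _ _
        · exact (Nat.dvd_of_mem_primeFactors hq).mul_left _
      intro n
      rw [← hFS (n + T), ← hFS n, add_right_comm]
      exact hTper _ (by omega)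
    refine Nat.le_of_dvd hT (Nat.Coprime.mul_dvd_of_dvd_of_dvd ?_ ?_ ?_)
    · refine Nat.Coprime.pow_left _ (Nat.Coprime.prod_right fun q hq => ?_)
      rw [Nat.coprime_primes hp (hprime q hq)]
      rintro rfl
      rcases Finset.mem_union.1 hq with h | h
      · exact ((hmemA p).1 h).2.2.1 (hpa.mul_right c)
      · exact ((hmemB p).1 h).2.2.1 hpa
    · obtain ⟨M, hM, hcop, hMper⟩ := exists_coprime_periodic_localTerm hp
        (Nat.mem_primeFactors.2 ⟨hp, (hpa.mul_right c).mul_right _, hM0⟩) hFT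
      refine (Nat.Coprime.pow_left _ hcop).dvd_of_dvd_mul_right ?_
      split_ifs with h
      · exact pow_factorization_dvd_of_periodic hk ha hc hp hpa hroot
          (mul_ne_zero hT.ne' hM) hMper
      · exact pow_factorization_add_dvd_of_periodic hk ha hc hp hroot (by omega) hMper
    · refine Finset.prod_primes_dvd _ (fun q hq => (hprime q hq).prime) fun q hq => ?_
      rcases Finset.mem_union.1 hq with h | h
      · obtain ⟨hqL, hq', hqac, hpq, hqk⟩ := (hmemA q).1 h
        obtain ⟨M, hM, hcop, hMper⟩ := exists_coprime_periodic_localTerm hp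
          (Nat.mem_primeFactors.2 ⟨hq', hqL.mul_left _, hM0⟩) hFT
        exact hcop.dvd_of_dvd_mul_right (dvd_of_periodic_of_dvd_Lk hk hq' hqac hqL hqk
          (periodic_dvdCount_sub_one_of_localTerm hp hq' hpq hMper))
      · obtain ⟨hqc, hq', hqa, hpq⟩ := (hmemB q).1 h
        obtain ⟨M, hM, hcop, hMper⟩ := exists_coprime_periodic_localTerm hp
          (Nat.mem_primeFactors.2 ⟨hq', (hqc.mul_left a).mul_right _, hM0⟩) hFT
        exact hcop.dvd_of_dvd_mul_right (dvd_of_periodic_of_dvd_common_difference hk hq' hqa hqc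
          (periodic_dvdCount_sub_one_of_localTerm hp hq' hpq hMper))
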